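/- For every ε with 0 < ε ≤ 1/2 there exists W₀ such that for all integers k ≥ 2, w ≥ W₀ and n with 2·k·w·(2·w + ⌈log₂ k⌉ + ⌈log₂ (2·w)⌉) < n, there exists a Boolean function f : (Fin n → Bool) → Bool that is computed with error at most 1/2 − ε by some probabilistic 2k-OBDD of width 3·w + 1 with some order π, but is not computed with error at most 1/2 − ε by any probabilistic 2k-OBDD of width ⌊√w / (log₂ k · log₂ w)⌋ with any order. -/

import Mathlib

/-- The bit read at step `t` by an OBDD with variable order `π` on input `x`:
at step `t` the variable `x (π (t mod n))` is read. -/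
def readBit {n : ℕ} (π : Equiv.Perm (Fin n)) (x : Fin n → Bool) (t : ℕ) : Bool :=
  if h : 0 < n then x (π ⟨t % n, Nat.mod_lt t h⟩) else false

/-- The probability distribution (row vector) over the states of a probabilistic
(k-)OBDD with order `π`, initial distribution `v0` and stochastic transition matrices `M`
after `t` steps on input `x`. -/
noncomputable def probDist {n w : ℕ} (π : Equiv.Perm (Fin n)) (v0 : Fin w → ℝ)
    (M : ℕ → Bool → Matrix (Fin w) (Fin w) ℝ) (x : Fin n → Bool) : ℕ → Fin w → ℝ
  | 0 => v0
  | t + 1 => Matrix.vecMul (probDist π v0 M x t) (M t (readBit π x t))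

/-- `f` is computed with error at most `1/2 - ε` by some probabilistic `k`-OBDD of
width `w` on `n` variables (with some order `π`). -/
def probComputes (k w n : ℕ) (ε : ℝ) (f : (Fin n → Bool) → Bool) : Prop :=
  ∃ (π : Equiv.Perm (Fin n)) (v0 : Fin w → ℝ)
    (M : ℕ → Bool → Matrix (Fin w) (Fin w) ℝ) (A : Finset (Fin w)),
    (∀ i, 0 ≤ v0 i) ∧ (∑ i, v0 i) = 1 ∧
    (∀ j b i i', 0 ≤ M j b i i') ∧ (∀ j b i, ∑ i', M j b i i' = 1) ∧
    (∀ x, f x = true → 1 / 2 + ε ≤ ∑ i ∈ A, probDist π v0 M x (k * n) i) ∧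
    (∀ x, f x = false → ∑ i ∈ A, probDist π v0 M x (k * n) i ≤ 1 / 2 - ε)


/-! ### Upper bound: a deterministic automaton recognising a small set -/

lemma det_machine {n W : ℕ} (K : ℕ) (σ : (Fin n → Bool) → ℕ → Fin W) (s0 acc : Fin W)
    (h0 : ∀ x, σ x 0 = s0)
    (hs : ∀ t x x', σ x t = σ x' t →
      readBit (Equiv.refl _) x t = readBit (Equiv.refl _) x' t → σ x (t + 1) = σ x' (t + 1))
    (f : (Fin n → Bool) → Bool) (hf : ∀ x, f x = true ↔ σ x (K * n) = acc)
    (ε : ℝ) (he : ε ≤ 1 / 2) : probComputes K W n ε f := by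
  classical
  let δ : ℕ → Bool → Fin W → Fin W := fun t b s =>
    if h : ∃ x, σ x t = s ∧ readBit (Equiv.refl _) x t = b then σ h.choose (t + 1) else s
  have hδ : ∀ t x, δ t (readBit (Equiv.refl _) x t) (σ x t) = σ x (t + 1) := by
    intro t x
    have h : ∃ x', σ x' t = σ x t ∧
        readBit (Equiv.refl _) x' t = readBit (Equiv.refl _) x t := ⟨x, rfl, rfl⟩
    simp only [δ, dif_pos h]
    exact hs t _ _ h.choose_spec.1 h.choose_spec.2
  let M : ℕ → Bool → Matrix (Fin W) (Fin W) ℝ := fun t b =>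
    Matrix.of fun s s' => if s' = δ t b s then 1 else 0
  have hd : ∀ x t, probDist (Equiv.refl _) (Pi.single s0 1) M x t = Pi.single (σ x t) 1 := by
    intro x t
    induction t with
    | zero => simp [probDist, h0]
    | succ t ih =>
      rw [probDist, ih, Matrix.single_one_vecMul]
      ext s'
      simp only [M, Matrix.row, Matrix.of_apply, hδ, Pi.single_apply]
  refine ⟨Equiv.refl _, Pi.single s0 1, M, {acc}, ?_, ?_, ?_, ?_, ?_, ?_⟩
  · intro i
    by_cases h : i = s0
    · subst h; simp
    · simp [h]
  · simp
  · intro j b i i'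
    simp only [M, Matrix.of_apply]
    split_ifs <;> norm_num
  · intro j b i
    simp [M]
  · intro x hx
    rw [hd, (hf x).1 hx]
    simp
    linarith
  · intro x hx
    have : σ x (K * n) ≠ acc := fun h => by
      have := (hf x).2 h
      simp [hx] at this
    rw [hd]
    simp [Pi.single_apply, this]
    linarith

open Classical in
/-- The state of the set-recognising automaton after `t` steps. -/
noncomputable def trieState {n w : ℕ} (e : ℕ → Fin w → (Fin n → Bool)) (x : Fin n → Bool)
    (t : ℕ) : Option (Option (Fin w)) :=
  if ∃ p < t / n, ∃ i, e p i = x then none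
  else if h : ∃ i, ∀ v : Fin n, v.val < t % n → e (t / n) i v = x v then some (some h.choose)
  else some none

lemma div_mod_succ_lt {n t : ℕ} (h : t % n + 1 < n) :
    (t + 1) / n = t / n ∧ (t + 1) % n = t % n + 1 := by
  have h1 := Nat.div_add_mod t n
  have h2 : t + 1 = (t % n + 1) + n * (t / n) := by omega
  have hn : 0 < n := by omega
  constructor
  · conv_lhs => rw [h2]
    rw [Nat.add_mul_div_left _ _ hn, Nat.div_eq_of_lt h, zero_add]
  · conv_lhs => rw [h2]
    rw [Nat.add_mul_mod_self_left, Nat.mod_eq_of_lt h]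

lemma div_mod_succ_eq {n t : ℕ} (hn : 0 < n) (h : t % n + 1 = n) :
    (t + 1) / n = t / n + 1 ∧ (t + 1) % n = 0 := by
  have h1 := Nat.div_add_mod t n
  have h2 : t + 1 = n * (t / n + 1) := by rw [mul_add]; omega
  constructor
  · conv_lhs => rw [h2]
    rw [Nat.mul_div_cancel_left _ hn]
  · conv_lhs => rw [h2]
    rw [Nat.mul_mod_right]

lemma trieState_step {n w : ℕ} (hn : 0 < n) (e : ℕ → Fin w → (Fin n → Bool)) (t : ℕ)
    (x x' : Fin n → Bool) (hst : trieState e x t = trieState e x' t)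
    (hb : readBit (Equiv.refl _) x t = readBit (Equiv.refl _) x' t) :
    trieState e x (t + 1) = trieState e x' (t + 1) := by
  classical
  have hb' : x ⟨t % n, Nat.mod_lt t hn⟩ = x' ⟨t % n, Nat.mod_lt t hn⟩ := by
    simpa [readBit, hn] using hb
  have hmono : t / n ≤ (t + 1) / n := Nat.div_le_div_right (Nat.le_succ t)
  by_cases hd : ∃ p < t / n, ∃ i, e p i = x
  · have hd' : ∃ p < t / n, ∃ i, e p i = x' := by
      by_contra hc
      unfold trieState at hst
      rw [if_pos hd, if_neg hc] at hst
      split_ifs at hst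
    obtain ⟨p, hp, i, hi⟩ := hd
    obtain ⟨p', hp', i', hi'⟩ := hd'
    unfold trieState
    rw [if_pos ⟨p, hp.trans_le hmono, i, hi⟩, if_pos ⟨p', hp'.trans_le hmono, i', hi'⟩]
  have hd' : ¬ ∃ p < t / n, ∃ i, e p i = x' := by
    intro hc
    unfold trieState at hst
    rw [if_neg hd, if_pos hc] at hst
    split_ifs at hst
  unfold trieState at hst
  rw [if_neg hd, if_neg hd'] at hst
  have hlt := Nat.mod_lt t hn
  by_cases ha : ∃ i, ∀ v : Fin n, v.val < t % n → e (t / n) i v = x v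
  · have ha' : ∃ i, ∀ v : Fin n, v.val < t % n → e (t / n) i v = x' v := by
      by_contra hc
      rw [dif_pos ha, dif_neg hc] at hst
      simp at hst
    rw [dif_pos ha, dif_pos ha'] at hst
    have hc : ha.choose = ha'.choose := by simpa using hst
    have hagree : ∀ v : Fin n, v.val < t % n + 1 → x v = x' v := by
      intro v hv
      rcases Nat.lt_succ_iff_lt_or_eq.1 hv with h | h
      · rw [← ha.choose_spec v h, ← ha'.choose_spec v h, hc]
      · have : v = ⟨t % n, Nat.mod_lt t hn⟩ := Fin.ext h
        rw [this, hb']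
    by_cases hend : t % n + 1 = n
    · have : x = x' := funext fun v => hagree v (by rw [hend]; exact v.2)
      rw [this]
    · obtain ⟨h1, h2⟩ := div_mod_succ_lt (n := n) (t := t) (by omega)
      unfold trieState
      rw [h1, h2, if_neg hd, if_neg hd']
      have hP : (fun i : Fin w => ∀ v : Fin n, v.val < t % n + 1 → e (t / n) i v = x v) =
          (fun i : Fin w => ∀ v : Fin n, v.val < t % n + 1 → e (t / n) i v = x' v) := by
        funext i
        apply propext
        constructor
        · intro h v hv
          rw [h v hv, hagree v hv]
        · intro h v hv
          rw [h v hv, hagree v hv]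
      have key : ∀ P Q : Fin w → Prop, P = Q →
          (if h : ∃ i, P i then some (some h.choose) else some none) =
          (if h : ∃ i, Q i then some (some h.choose) else (some none : Option (Option (Fin w)))) := by
        intro P Q h
        subst h
        rfl
      convert key _ _ hP
  · have ha' : ¬ ∃ i, ∀ v : Fin n, v.val < t % n → e (t / n) i v = x' v := by
      intro hc
      rw [dif_neg ha, dif_pos hc] at hst
      simp at hst
    by_cases hend : t % n + 1 = n
    · obtain ⟨h1, h2⟩ := div_mod_succ_eq hn hend
      have aux : ∀ z : Fin n → Bool, (¬ ∃ p < t / n, ∃ i, e p i = z) →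
          (¬ ∃ i, ∀ v : Fin n, v.val < t % n → e (t / n) i v = z v) →
          ¬ ∃ p < t / n + 1, ∃ i, e p i = z := by
        rintro z hz1 hz2 ⟨p, hp, i, hi⟩
        rcases Nat.lt_succ_iff_lt_or_eq.1 hp with h | h
        · exact hz1 ⟨p, h, i, hi⟩
        · subst h
          exact hz2 ⟨i, fun v _ => by rw [hi]⟩
      unfold trieState
      rw [h1, h2, if_neg (aux x hd ha), if_neg (aux x' hd' ha')]
      simp
    · obtain ⟨h1, h2⟩ := div_mod_succ_lt (n := n) (t := t) (by omega)
      unfold trieState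
      rw [h1, h2, if_neg hd, if_neg hd', dif_neg, dif_neg]
      · rintro ⟨i, hi⟩
        exact ha' ⟨i, fun v hv => hi v (by omega)⟩
      · rintro ⟨i, hi⟩
        exact ha ⟨i, fun v hv => hi v (by omega)⟩

open Classical in
lemma set_computes {n w K : ℕ} (hn : 0 < n) (hw : 1 ≤ w) (e : ℕ → Fin w → (Fin n → Bool))
    (ε : ℝ) (he : ε ≤ 1 / 2) :
    probComputes K (3 * w + 1) n ε (fun x => decide (∃ p < K, ∃ i, e p i = x)) := by
  have hcard : Fintype.card (Option (Option (Fin w))) ≤ Fintype.card (Fin (3 * w + 1)) := by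
    simp
    omega
  obtain ⟨ι⟩ := Function.Embedding.nonempty_of_card_le hcard
  refine det_machine K (fun x t => ι (trieState e x t))
    (ι (trieState e (fun _ => false) 0)) (ι none) ?_ ?_ _ ?_ ε he
  · intro x
    simp [trieState]
  · intro t x x' h hb
    exact congrArg ι (trieState_step hn e t x x' (ι.injective h) hb)
  · intro x
    simp only [decide_eq_true_eq, ι.injective.eq_iff]
    unfold trieState
    rw [Nat.mul_div_cancel _ hn]
    constructor
    · intro h
      rw [if_pos h]
    · intro h
      by_contra hc
      rw [if_neg hc] at h
      split_ifs at h

/-! ### Lower bound: counting functions computed by narrow programs -/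

/-- Distribution-valued functions produced by `L` reading steps on the variables `V`. -/
inductive Reach {V : Type} {d : ℕ} : ℕ → ((V → Bool) → Fin d → ℝ) → Prop
  | base (v : Fin d → ℝ) (h0 : ∀ i, 0 ≤ v i) (h1 : ∑ i, v i = 1) : Reach 0 (fun _ => v)
  | step (L : ℕ) (F : (V → Bool) → Fin d → ℝ) (u : V) (N : Bool → Matrix (Fin d) (Fin d) ℝ)
      (h0 : ∀ b i j, 0 ≤ N b i j) (h1 : ∀ b i, ∑ j, N b i j = 1) (hF : Reach L F) :
      Reach (L + 1) (fun y => Matrix.vecMul (F y) (N (y u)))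

lemma vecMul_nonneg' {d : ℕ} {v : Fin d → ℝ} {N : Matrix (Fin d) (Fin d) ℝ}
    (hv : ∀ i, 0 ≤ v i) (hN : ∀ i j, 0 ≤ N i j) (j : Fin d) : 0 ≤ Matrix.vecMul v N j := by
  simp only [Matrix.vecMul, dotProduct]
  exact Finset.sum_nonneg fun i _ => mul_nonneg (hv i) (hN i j)

lemma vecMul_sum' {d : ℕ} {v : Fin d → ℝ} {N : Matrix (Fin d) (Fin d) ℝ}
    (hN : ∀ i, ∑ j, N i j = 1) : ∑ j, Matrix.vecMul v N j = ∑ i, v i := by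
  simp only [Matrix.vecMul, dotProduct]
  rw [Finset.sum_comm]
  refine Finset.sum_congr rfl fun i _ => ?_
  rw [← Finset.mul_sum, hN, mul_one]

lemma Reach.nonneg {V : Type} {d L : ℕ} {F : (V → Bool) → Fin d → ℝ} (h : Reach L F) :
    ∀ y i, 0 ≤ F y i := by
  induction h with
  | base v h0 h1 => intro _ i; exact h0 i
  | step L F u N h0 h1 hF ih => intro y i; exact vecMul_nonneg' (ih y) (h0 _) i

lemma Reach.sum_one {V : Type} {d L : ℕ} {F : (V → Bool) → Fin d → ℝ} (h : Reach L F) :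
    ∀ y, ∑ i, F y i = 1 := by
  induction h with
  | base v h0 h1 => intro _; exact h1
  | step L F u N h0 h1 hF ih => intro y; rw [vecMul_sum' (h1 _), ih]

lemma Reach.absorb {V : Type} {d L : ℕ} {F : (V → Bool) → Fin d → ℝ} (h : Reach L F)
    (N : Matrix (Fin d) (Fin d) ℝ) (h0 : ∀ i j, 0 ≤ N i j) (h1 : ∀ i, ∑ j, N i j = 1) :
    Reach L (fun y => Matrix.vecMul (F y) N) := by
  cases h with
  | base v g0 g1 =>
    exact Reach.base _ (vecMul_nonneg' g0 h0) (by rw [vecMul_sum' h1, g1])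
  | step L F u N' g0 g1 hF =>
    have := Reach.step L F u (fun b => N' b * N)
      (fun b i j => by
        rw [Matrix.mul_apply]
        exact Finset.sum_nonneg fun a _ => mul_nonneg (g0 b i a) (h0 a j))
      (fun b i => by
        have : ∀ j, (N' b * N) i j = Matrix.vecMul (N' b i) N j := fun j => rfl
        simp only [this]
        rw [vecMul_sum' h1, g1]) hF
    simpa [Matrix.vecMul_vecMul] using this

open Classical in
/-- Extension of an assignment of the variables `V` by zeros. -/
noncomputable def extAssign {V : Type} {n : ℕ} (φ : V ↪ Fin n) (y : V → Bool) : Fin n → Bool :=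
  fun v => if h : ∃ u, φ u = v then y h.choose else false

lemma extAssign_apply {V : Type} {n : ℕ} (φ : V ↪ Fin n) (y : V → Bool) (u : V) :
    extAssign φ y (φ u) = y u := by
  have h : ∃ u', φ u' = φ u := ⟨u, rfl⟩
  simp only [extAssign, dif_pos h]
  rw [φ.injective h.choose_spec]

lemma extAssign_inj {V : Type} {n : ℕ} (φ : V ↪ Fin n) {y y' : V → Bool}
    (h : extAssign φ y = extAssign φ y') : y = y' := by
  funext u
  rw [← extAssign_apply φ y u, h, extAssign_apply]

open Classical in
lemma reach_pass {V : Type} [Fintype V] {n d : ℕ} (φ : V ↪ Fin n) (π : Equiv.Perm (Fin n))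
    (v0 : Fin d → ℝ) (M : ℕ → Bool → Matrix (Fin d) (Fin d) ℝ)
    (hM0 : ∀ j b i i', 0 ≤ M j b i i') (hM1 : ∀ j b i, ∑ i', M j b i i' = 1) (p L : ℕ)
    (h : Reach L (fun y => probDist π v0 M (extAssign φ y) (p * n))) (j : ℕ) (hj : j ≤ n) :
    Reach (L + (Finset.univ.filter fun v : Fin n => v.val < j ∧ ∃ u, φ u = π v).card)
      (fun y => probDist π v0 M (extAssign φ y) (p * n + j)) := by
  induction j with
  | zero => simpa using h
  | succ j ih =>
    have ih := ih (by omega)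
    have hmod : (p * n + j) % n = j := by
      rw [mul_comm, Nat.mul_add_mod, Nat.mod_eq_of_lt hj]
    have hrd : ∀ y, readBit π (extAssign φ y) (p * n + j) = extAssign φ y (π ⟨j, hj⟩) := by
      intro y
      have hn : 0 < n := by omega
      simp [readBit, hn, hmod]
    by_cases hr : ∃ u, φ u = π ⟨j, hj⟩
    · obtain ⟨u, hu⟩ := hr
      have hset : (Finset.univ.filter fun v : Fin n => v.val < j + 1 ∧ ∃ u, φ u = π v) =
          insert ⟨j, hj⟩
            (Finset.univ.filter fun v : Fin n => v.val < j ∧ ∃ u, φ u = π v) := by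
        ext v
        simp only [Finset.mem_filter, Finset.mem_univ, true_and, Finset.mem_insert]
        constructor
        · rintro ⟨h1, h2⟩
          rcases Nat.lt_succ_iff_lt_or_eq.1 h1 with h3 | h3
          · exact Or.inr ⟨h3, h2⟩
          · exact Or.inl (Fin.ext h3)
        · rintro (h1 | ⟨h1, h2⟩)
          · subst h1
            exact ⟨Nat.lt_succ_self j, u, hu⟩
          · exact ⟨by omega, h2⟩
      rw [hset, Finset.card_insert_of_notMem (by simp), ← add_assoc]
      have := Reach.step _ _ u (M (p * n + j)) (hM0 _) (hM1 _) ih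
      convert this using 2 with y
      rw [← add_assoc, probDist, hrd, ← hu, extAssign_apply]
    · have hset : (Finset.univ.filter fun v : Fin n => v.val < j + 1 ∧ ∃ u, φ u = π v) =
            (Finset.univ.filter fun v : Fin n => v.val < j ∧ ∃ u, φ u = π v) := by
        ext v
        simp only [Finset.mem_filter, Finset.mem_univ, true_and]
        constructor
        · rintro ⟨h1, h2⟩
          rcases Nat.lt_succ_iff_lt_or_eq.1 h1 with h3 | h3
          · exact ⟨h3, h2⟩
          · have : v = ⟨j, hj⟩ := Fin.ext h3
            rw [this] at h2
            exact absurd h2 hr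
        · rintro ⟨h1, h2⟩
          exact ⟨by omega, h2⟩
      rw [hset]
      have := ih.absorb (M (p * n + j) false) (hM0 _ _) (hM1 _ _)
      convert this using 2 with y
      rw [← add_assoc, probDist, hrd]
      congr 2
      simp [extAssign, hr]

lemma reach_all {V : Type} [Fintype V] {n d : ℕ} (φ : V ↪ Fin n) (π : Equiv.Perm (Fin n))
    (v0 : Fin d → ℝ) (M : ℕ → Bool → Matrix (Fin d) (Fin d) ℝ)
    (hv0 : ∀ i, 0 ≤ v0 i) (hv1 : ∑ i, v0 i = 1)
    (hM0 : ∀ j b i i', 0 ≤ M j b i i') (hM1 : ∀ j b i, ∑ i', M j b i i' = 1) (K : ℕ) :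
    Reach (K * Fintype.card V) (fun y => probDist π v0 M (extAssign φ y) (K * n)) := by
  classical
  induction K with
  | zero => simpa [probDist] using Reach.base v0 hv0 hv1
  | succ K ih =>
    have := reach_pass φ π v0 M hM0 hM1 K _ ih n le_rfl
    have hc : (Finset.univ.filter fun v : Fin n => v.val < n ∧ ∃ u, φ u = π v).card =
        Fintype.card V := by
      have : (Finset.univ.filter fun v : Fin n => v.val < n ∧ ∃ u, φ u = π v) =
          Finset.univ.map (φ.trans π.symm.toEmbedding) := by
        ext v
        simp [Equiv.symm_apply_eq]
      rw [this, Finset.card_map, Finset.card_univ]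
    rw [hc] at this
    simpa [add_mul] using this

open Classical in
/-- A finite net for the functions in `Reach L`. -/
noncomputable def netFun (V : Type) [Fintype V] (d Q : ℕ) :
    ℕ → Finset ((V → Bool) → Fin d → ℝ)
  | 0 => (Finset.univ : Finset (Fin d → Fin (Q + 1))).image fun c _ i => ((c i : ℕ) : ℝ) / Q
  | L + 1 => (netFun V d Q L ×ˢ
      (Finset.univ : Finset (V × (Bool → Fin d → Fin d → Fin (Q + 1))))).image
        fun p y => Matrix.vecMul (p.1 y)
          (Matrix.of fun i j => ((p.2.2 (y p.2.1) i j : ℕ) : ℝ) / Q)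

lemma netFun_card (V : Type) [Fintype V] (d Q L : ℕ) :
    (netFun V d Q L).card ≤
      (Q + 1) ^ d * (Fintype.card V * (Q + 1) ^ (2 * d ^ 2)) ^ L := by
  classical
  induction L with
  | zero =>
    refine Finset.card_image_le.trans ?_
    simp
  | succ L ih =>
    refine Finset.card_image_le.trans ?_
    rw [Finset.card_product, pow_succ, ← mul_assoc]
    refine Nat.mul_le_mul ih ?_
    apply le_of_eq
    simp only [Finset.card_univ, Fintype.card_prod, Fintype.card_fun, Fintype.card_fin,
      Fintype.card_bool]
    congr 1
    rw [← pow_mul, ← pow_mul]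
    congr 1
    ring

lemma round_exists {Q : ℕ} (hQ : 0 < Q) (r : ℝ) (h0 : 0 ≤ r) (h1 : r ≤ 1) :
    ∃ c : Fin (Q + 1), ((c : ℕ) : ℝ) / Q ≤ r ∧ r - 1 / Q ≤ ((c : ℕ) : ℝ) / Q := by
  have hQ' : (0 : ℝ) < Q := by exact_mod_cast hQ
  refine ⟨⟨⌊(Q : ℝ) * r⌋₊, ?_⟩, ?_, ?_⟩
  · rw [Nat.lt_succ_iff]
    exact Nat.floor_le_of_le (by nlinarith)
  · rw [div_le_iff₀ hQ']
    have := Nat.floor_le (show 0 ≤ (Q : ℝ) * r by positivity)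
    simpa [mul_comm] using this
  · have := Nat.lt_floor_add_one ((Q : ℝ) * r)
    rw [le_div_iff₀ hQ', sub_mul, one_div, inv_mul_cancel₀ hQ'.ne']
    simp only
    linarith

lemma netFun_approx {V : Type} [Fintype V] {d Q L : ℕ} (hQ : 0 < Q)
    {F : (V → Bool) → Fin d → ℝ} (h : Reach L F) :
    ∃ G ∈ netFun V d Q L, ∀ y, ∑ i, |F y i - G y i| ≤ (L + 1) * (d / Q : ℝ) := by
  classical
  have hQ' : (0 : ℝ) < Q := by exact_mod_cast hQ
  have hle1 : ∀ v : Fin d → ℝ, (∀ i, 0 ≤ v i) → ∑ i, v i = 1 → ∀ i, v i ≤ 1 := by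
    intro v h0 h1 i
    rw [← h1]
    exact Finset.single_le_sum (fun j _ => h0 j) (Finset.mem_univ i)
  induction h with
  | base v h0 h1 =>
    choose c hc1 hc2 using fun i => round_exists hQ (v i) (h0 i) (hle1 v h0 h1 i)
    refine ⟨fun _ i => ((c i : ℕ) : ℝ) / Q, ?_, ?_⟩
    · simp only [netFun]
      exact Finset.mem_image.2 ⟨c, Finset.mem_univ _, rfl⟩
    · intro y
      calc ∑ i, |v i - ((c i : ℕ) : ℝ) / Q| ≤ ∑ _i : Fin d, (1 / Q : ℝ) := by
            refine Finset.sum_le_sum fun i _ => ?_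
            rw [abs_of_nonneg (by linarith [hc1 i])]
            linarith [hc2 i]
        _ = (((0 : ℕ) : ℝ) + 1) * (d / Q : ℝ) := by simp [div_eq_mul_inv]
  | step L F u N h0 h1 hF ih =>
    obtain ⟨G, hG, hFG⟩ := ih
    choose c hc1 hc2 using fun b i j =>
      round_exists hQ (N b i j) (h0 b i j) (hle1 (N b i) (h0 b i) (h1 b i) j)
    refine ⟨fun y => Matrix.vecMul (G y) (Matrix.of fun i j => ((c (y u) i j : ℕ) : ℝ) / Q),
      ?_, ?_⟩
    · simp only [netFun]
      refine Finset.mem_image.2 ⟨(G, u, c), ?_, rfl⟩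
      simp [hG]
    · intro y
      set b := y u
      have hrow : ∀ i, ∑ j, ((c b i j : ℕ) : ℝ) / Q ≤ 1 := fun i => by
        rw [← h1 b i]
        exact Finset.sum_le_sum fun j _ => hc1 b i j
      have hpt : ∀ j, |Matrix.vecMul (F y) (N b) j -
          Matrix.vecMul (G y) (Matrix.of fun i j => ((c b i j : ℕ) : ℝ) / Q) j| ≤
          ∑ i, (F y i * (1 / Q) + |F y i - G y i| * (((c b i j : ℕ) : ℝ) / Q)) := by
        intro j
        simp only [Matrix.vecMul, dotProduct, Matrix.of_apply]
        rw [← Finset.sum_sub_distrib]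
        refine (Finset.abs_sum_le_sum_abs _ _).trans (Finset.sum_le_sum fun i _ => ?_)
        have hc0 : 0 ≤ ((c b i j : ℕ) : ℝ) / Q := by positivity
        have hF0 := hF.nonneg y i
        have e1 : F y i * N b i j - G y i * (((c b i j : ℕ) : ℝ) / Q) =
            F y i * (N b i j - ((c b i j : ℕ) : ℝ) / Q) +
            (F y i - G y i) * (((c b i j : ℕ) : ℝ) / Q) := by ring
        rw [e1]
        refine (abs_add_le _ _).trans (add_le_add ?_ ?_)
        · rw [abs_mul, abs_of_nonneg hF0]
          refine mul_le_mul_of_nonneg_left ?_ hF0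
          rw [abs_of_nonneg (by linarith [hc1 b i j])]
          linarith [hc2 b i j]
        · rw [abs_mul, abs_of_nonneg hc0]
      calc _ ≤ ∑ j, ∑ i, (F y i * (1 / Q) + |F y i - G y i| * (((c b i j : ℕ) : ℝ) / Q)) :=
            Finset.sum_le_sum fun j _ => hpt j
        _ = ∑ i, (F y i * (d / Q) + |F y i - G y i| * ∑ j, ((c b i j : ℕ) : ℝ) / Q) := by
            rw [Finset.sum_comm]
            refine Finset.sum_congr rfl fun i _ => ?_
            rw [Finset.sum_add_distrib, Finset.sum_const, Finset.card_univ,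
              Fintype.card_fin, nsmul_eq_mul, ← Finset.mul_sum]
            ring
        _ ≤ ∑ i, (F y i * (d / Q) + |F y i - G y i|) := by
            refine Finset.sum_le_sum fun i _ => ?_
            have := mul_le_mul_of_nonneg_left (hrow i) (abs_nonneg (F y i - G y i))
            linarith
        _ = d / Q + ∑ i, |F y i - G y i| := by
            rw [Finset.sum_add_distrib, ← Finset.sum_mul, hF.sum_one, one_mul]
        _ ≤ d / Q + (L + 1) * (d / Q : ℝ) := by linarith [hFG y]
        _ = (((L + 1 : ℕ) : ℝ) + 1) * (d / Q : ℝ) := by push_cast; ring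

open Classical in
/-- All Boolean functions obtained by thresholding the net. -/
noncomputable def boolNet (V : Type) [Fintype V] (d Q L : ℕ) : Finset ((V → Bool) → Bool) :=
  (netFun V d Q L ×ˢ (Finset.univ : Finset (Finset (Fin d)))).image
    fun p y => decide (1 / 2 ≤ ∑ i ∈ p.2, p.1 y i)

lemma boolNet_card (V : Type) [Fintype V] (d Q L : ℕ) :
    (boolNet V d Q L).card ≤
      (Q + 1) ^ d * (Fintype.card V * (Q + 1) ^ (2 * d ^ 2)) ^ L * 2 ^ d := by
  classical
  refine Finset.card_image_le.trans ?_
  rw [Finset.card_product]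
  refine Nat.mul_le_mul (netFun_card V d Q L) ?_
  simp

lemma mem_boolNet {V : Type} [Fintype V] {n d K Q : ℕ} (hQ : 0 < Q) (φ : V ↪ Fin n) {ε : ℝ}
    (herr : ((K * Fintype.card V : ℕ) + 1 : ℝ) * (d / Q : ℝ) < ε)
    {f : (Fin n → Bool) → Bool} (hf : probComputes K d n ε f) :
    (fun y => f (extAssign φ y)) ∈ boolNet V d Q (K * Fintype.card V) := by
  classical
  obtain ⟨π, v0, M, A, hv0, hv1, hM0, hM1, ht, hfl⟩ := hf
  have hR := reach_all φ π v0 M hv0 hv1 hM0 hM1 K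
  obtain ⟨G, hG, hFG⟩ := netFun_approx hQ hR
  refine Finset.mem_image.2 ⟨(G, A), by simp [hG], ?_⟩
  funext y
  have hlt : |∑ i ∈ A, probDist π v0 M (extAssign φ y) (K * n) i - ∑ i ∈ A, G y i| < ε := by
    rw [← Finset.sum_sub_distrib]
    refine (Finset.abs_sum_le_sum_abs _ _).trans_lt (lt_of_le_of_lt ?_ herr)
    refine le_trans ?_ (hFG y)
    exact Finset.sum_le_sum_of_subset_of_nonneg (Finset.subset_univ _)
      fun _ _ _ => abs_nonneg _
  rw [abs_lt] at hlt
  cases hfy : f (extAssign φ y) with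
  | true =>
    have := ht _ hfy
    simp only [decide_eq_true_eq]
    linarith [hlt.2]
  | false =>
    have := hfl _ hfy
    simp only [decide_eq_false_iff_not, not_le]
    linarith [hlt.1]

/-! ### Numerical estimates -/

lemma clog_le_two_logb {a : ℕ} (ha : 2 ≤ a) : (Nat.clog 2 a : ℝ) ≤ 2 * Real.logb 2 a := by
  have h1 : (1 : ℝ) ≤ Real.logb 2 a := by
    rw [Real.le_logb_iff_rpow_le (by norm_num) (by positivity)]
    simpa using (by exact_mod_cast ha : (2 : ℝ) ≤ a)
  have h2 : (Nat.clog 2 a : ℝ) < Real.logb 2 a + 1 := by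
    have := Real.natCeil_logb_natCast 2 a
    push_cast at this
    rw [← this]
    exact Nat.ceil_lt_add_one (by linarith)
  linarith

lemma numerics (ε : ℝ) (he : 0 < ε) : ∃ W₀ : ℕ, 2 ≤ W₀ ∧ ∀ k w d : ℕ, 2 ≤ k → W₀ ≤ w →
    1 ≤ d → (d : ℝ) ≤ Real.sqrt w / (Real.logb 2 k * Real.logb 2 w) →
    ∃ l q : ℕ, 1 ≤ l ∧ 2 * k * w ≤ 2 ^ l ∧
      ((2 * k * (2 * l) : ℕ) + 1 : ℝ) * (d / (2 ^ q : ℕ) : ℝ) < ε ∧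
      4 * l + 6 * d ^ 2 * (q + 1) < w := by
  obtain ⟨E, hE⟩ := pow_unbounded_of_one_lt (1 / ε) (by norm_num : (1 : ℝ) < 2)
  refine ⟨2 ^ (12 * (E + 14)), ?_, ?_⟩
  · calc 2 = 2 ^ 1 := rfl
      _ ≤ _ := Nat.pow_le_pow_right (by norm_num) (by omega)
  intro k w d hk hw hd hdr
  have hw2 : 2 ≤ w := le_trans (by
    calc 2 = 2 ^ 1 := rfl
      _ ≤ 2 ^ (12 * (E + 14)) := Nat.pow_le_pow_right (by norm_num) (by omega)) hw
  set a := Nat.clog 2 k with ha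
  set b := Nat.clog 2 w with hb
  set x := Real.logb 2 k with hx
  set z := Real.logb 2 w with hz
  have hka : k ≤ 2 ^ a := Nat.le_pow_clog (by norm_num) k
  have hwb : w ≤ 2 ^ b := Nat.le_pow_clog (by norm_num) w
  have hax : (a : ℝ) ≤ 2 * x := clog_le_two_logb hk
  have hbz : (b : ℝ) ≤ 2 * z := clog_le_two_logb hw2
  have hx1 : 1 ≤ x := by
    rw [hx, Real.le_logb_iff_rpow_le (by norm_num) (by positivity)]
    simpa using (by exact_mod_cast hk : (2 : ℝ) ≤ k)
  have hzE : (12 * (E + 14) : ℝ) ≤ z := by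
    rw [hz, Real.le_logb_iff_rpow_le (by norm_num) (by positivity)]
    have : (2 : ℝ) ^ (12 * (E + 14)) ≤ w := by exact_mod_cast hw
    rw [← Real.rpow_natCast] at this
    simpa using this
  have hE0 : (0 : ℝ) ≤ E := by positivity
  have hz1 : 1 ≤ z := by linarith
  have hxz : 0 < x * z := by positivity
  set s := Real.sqrt w with hs
  have hss : s * s = w := Real.mul_self_sqrt (by positivity)
  have hs0 : 0 ≤ s := Real.sqrt_nonneg _
  have hds : (d : ℝ) * (x * z) ≤ s := by rwa [le_div_iff₀ hxz] at hdr
  have hd1 : (1 : ℝ) ≤ d := by exact_mod_cast hd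
  have hxzs : x * z ≤ s := by nlinarith
  have hx1z : z ≤ x * z := by nlinarith
  have hxx : x ≤ x * z := by nlinarith
  have hdw : d ≤ w := by
    have h1 : (d : ℝ) ≤ w := by
      have : (d : ℝ) ≤ s := by nlinarith
      have hs1 : 1 ≤ s := by linarith
      nlinarith
    exact_mod_cast h1
  refine ⟨1 + a + b, E + 5 + 2 * a + 2 * b, by omega, ?_, ?_, ?_⟩
  · rw [pow_add, pow_add]
    exact Nat.mul_le_mul (Nat.mul_le_mul (by norm_num) hka) hwb
  · set l := 1 + a + b with hl
    have hl2 : l ≤ 2 ^ l := Nat.lt_two_pow_self.le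
    have hnat : (2 * k * (2 * l) + 1) * d ≤ 2 ^ (5 + 2 * a + 2 * b) := by
      calc (2 * k * (2 * l) + 1) * d ≤ (8 * (2 ^ a * 2 ^ l)) * 2 ^ b := by
            refine Nat.mul_le_mul ?_ (hdw.trans hwb)
            have h1 : k * l ≤ 2 ^ a * 2 ^ l := Nat.mul_le_mul hka hl2
            have h2 : 1 ≤ 2 ^ a * 2 ^ l := Nat.one_le_iff_ne_zero.2 (by positivity)
            nlinarith
        _ = 2 ^ (4 + 2 * a + 2 * b) := by
            rw [hl]
            ring
        _ ≤ _ := Nat.pow_le_pow_right (by norm_num) (by omega)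
    have hreal : ((2 * k * (2 * l) : ℕ) + 1 : ℝ) * d ≤ 2 ^ (5 + 2 * a + 2 * b) := by
      exact_mod_cast hnat
    have hE' : 1 < ε * 2 ^ E := by
      rw [div_lt_iff₀ he] at hE
      linarith
    rw [← mul_div_assoc, div_lt_iff₀ (by positivity)]
    refine hreal.trans_lt ?_
    have : E + 5 + 2 * a + 2 * b = E + (5 + 2 * a + 2 * b) := by ring
    rw [this]
    push_cast
    rw [pow_add 2 E, ← mul_assoc]
    exact lt_mul_of_one_lt_left (by positivity) hE'
  · have hq : ((E + 5 + 2 * a + 2 * b + 1 : ℕ) : ℝ) ≤ (E + 14) * (x * z) := by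
      push_cast
      have : (E + 6 : ℝ) * 1 ≤ (E + 6) * (x * z) :=
        mul_le_mul_of_nonneg_left (by linarith) (by positivity)
      nlinarith
    have hdq : (12 * (E + 14)) * ((d : ℝ) ^ 2 * (x * z)) ≤ w := by
      have h1 : ((d : ℝ) * (x * z)) * ((d : ℝ) * (x * z)) ≤ s * s :=
        mul_le_mul hds hds (by positivity) hs0
      have h2 : (12 * (E + 14)) * ((d : ℝ) ^ 2 * (x * z)) ≤ (x * z) * ((d : ℝ) ^ 2 * (x * z)) :=
        mul_le_mul_of_nonneg_right (by linarith) (by positivity)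
      nlinarith
    have h6 : (6 : ℝ) * d ^ 2 * ((E + 5 + 2 * a + 2 * b + 1 : ℕ) : ℝ) ≤ w / 2 := by
      have := mul_le_mul_of_nonneg_left hq (show (0 : ℝ) ≤ 6 * d ^ 2 by positivity)
      nlinarith
    have h4 : (4 : ℝ) * ((1 + a + b : ℕ) : ℝ) < w / 2 := by
      push_cast
      have h1 : (4 : ℝ) * (1 + a + b) ≤ 20 * s := by linarith
      have h2 : 168 ≤ s := by linarith
      nlinarith
    have : ((4 * (1 + a + b) + 6 * d ^ 2 * (E + 5 + 2 * a + 2 * b + 1) : ℕ) : ℝ) < w := by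
      push_cast at h6 h4 ⊢
      linarith
    exact_mod_cast this

lemma count_lt {k w d l q : ℕ} (hk : 2 ≤ k) (hd : 1 ≤ d) (hl : 1 ≤ l)
    (h : 4 * l + 6 * d ^ 2 * (q + 1) < w) :
    (2 ^ q + 1) ^ d * (2 * l * (2 ^ q + 1) ^ (2 * d ^ 2)) ^ (2 * k * (2 * l)) * 2 ^ d <
      2 ^ (l * (2 * k * w)) := by
  have hQ : 2 ^ q + 1 ≤ 2 ^ (q + 1) := by
    have := Nat.one_le_two_pow (n := q)
    rw [pow_succ]
    omega
  have hm : 2 * l ≤ 2 ^ (2 * l) := Nat.lt_two_pow_self.le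
  set L := 2 * k * (2 * l) with hL
  calc _ ≤ (2 ^ (q + 1)) ^ d * (2 ^ (2 * l) * (2 ^ (q + 1)) ^ (2 * d ^ 2)) ^ L * 2 ^ d := by
        gcongr
    _ = 2 ^ ((q + 1) * d + (2 * l + (q + 1) * (2 * d ^ 2)) * L + d) := by
        simp only [← pow_mul, ← pow_add]
    _ < _ := by
        apply Nat.pow_lt_pow_right (by norm_num)
        have hLkl : L = 4 * (k * l) := by rw [hL]; ring
        have hL2 : 2 ≤ L := by
          have : 2 * 1 ≤ k * l := Nat.mul_le_mul hk hl
          omega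
        have hdd : d ≤ d ^ 2 := by nlinarith
        have h1 : (q + 1) * d + d ≤ L * (d ^ 2 * (q + 1)) := by
          calc (q + 1) * d + d ≤ 2 * (d ^ 2 * (q + 1)) := by nlinarith
            _ ≤ _ := Nat.mul_le_mul_right _ hL2
        have h2 : L * (4 * l + 6 * d ^ 2 * (q + 1)) < L * w :=
          Nat.mul_lt_mul_of_pos_left h (by omega)
        have h3 : 2 * (l * (2 * k * w)) = L * w := by rw [hL]; ring
        nlinarith

open Classical in
/-- The function recognising the strings with address `ad j` and content `g j`. -/
noncomputable def famEnum {k w l n : ℕ} (φ : (Fin l ⊕ Fin l) ↪ Fin n)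
    (ad : (Fin (2 * k) × Fin w) ↪ (Fin l → Bool)) (g : (Fin (2 * k) × Fin w) → (Fin l → Bool))
    (p : ℕ) (i : Fin w) : Fin n → Bool :=
  if h : p < 2 * k then
    extAssign φ (Sum.elim (ad (⟨p, h⟩, i)) (g (⟨p, h⟩, i)))
  else fun _ => false

/-- Width hierarchy for bounded-error probabilistic `2k`-OBDDs: for every
`ε ∈ (0, 1/2]` there is `W₀` such that for `k ≥ 2`, `w ≥ W₀` and
`2kw(2w + ⌈log₂ k⌉ + ⌈log₂ 2w⌉) < n` there is a Boolean function computed with error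
at most `1/2 - ε` by a probabilistic `2k`-OBDD of width `3w + 1` but not by any of
width `⌊√w / (log₂ k · log₂ w)⌋`. -/
theorem prob_kOBDD_width_hierarchy :
    ∀ ε : ℝ, 0 < ε → ε ≤ 1 / 2 →
    ∃ W₀ : ℕ, ∀ k w n : ℕ, 2 ≤ k → W₀ ≤ w →
      2 * k * w * (2 * w + Nat.clog 2 k + Nat.clog 2 (2 * w)) < n →
      ∃ f : (Fin n → Bool) → Bool,
        probComputes (2 * k) (3 * w + 1) n ε f ∧
        ¬ probComputes (2 * k) ⌊Real.sqrt w / (Real.logb 2 k * Real.logb 2 w)⌋₊ n ε f := by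
  classical
  intro ε he he2
  obtain ⟨W₀, hW2, hW⟩ := numerics ε he
  refine ⟨W₀, fun k w n hk hw hn => ?_⟩
  have hn0 : 0 < n := by omega
  have hw1 : 1 ≤ w := by omega
  set d := ⌊Real.sqrt w / (Real.logb 2 k * Real.logb 2 w)⌋₊ with hd
  by_cases hd0 : d = 0
  · refine ⟨_, set_computes (K := 2 * k) hn0 hw1 (fun _ _ _ => false) ε he2, ?_⟩
    rw [hd0]
    rintro ⟨π, v0, M, A, -, h1, -⟩
    simp at h1
  have hd1 : 1 ≤ d := by omega
  have hdr : (d : ℝ) ≤ Real.sqrt w / (Real.logb 2 k * Real.logb 2 w) := by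
    rw [hd]
    refine Nat.floor_le ?_
    by_contra hc
    exact hd0 (Nat.floor_of_nonpos (le_of_not_ge hc))
  obtain ⟨l, q, hl, hlk, herr, hcount⟩ := hW k w d hk hw hd1 hdr
  have hln : 2 * l ≤ n := by
    have h1 : w ≤ 2 * k * w * (2 * w + Nat.clog 2 k + Nat.clog 2 (2 * w)) := by
      calc w = 1 * w * 1 := by ring
        _ ≤ _ := Nat.mul_le_mul (Nat.mul_le_mul_right _ (by omega)) (by omega)
    omega
  obtain ⟨φ⟩ : Nonempty ((Fin l ⊕ Fin l) ↪ Fin n) :=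
    Function.Embedding.nonempty_of_card_le (by simp; omega)
  obtain ⟨ad⟩ : Nonempty ((Fin (2 * k) × Fin w) ↪ (Fin l → Bool)) :=
    Function.Embedding.nonempty_of_card_le (by simpa using hlk)
  by_contra hcon
  push Not at hcon
  have hcV : Fintype.card (Fin l ⊕ Fin l) = 2 * l := by simp; omega
  let F : ((Fin (2 * k) × Fin w) → (Fin l → Bool)) → (Fin n → Bool) → Bool :=
    fun g x => decide (∃ p < 2 * k, ∃ i, famEnum φ ad g p i = x)
  have hmem : ∀ g, (fun y => F g (extAssign φ y)) ∈
      boolNet (Fin l ⊕ Fin l) d (2 ^ q) (2 * k * Fintype.card (Fin l ⊕ Fin l)) := by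
    intro g
    refine mem_boolNet (by positivity) φ (ε := ε) ?_
      (hcon _ (set_computes hn0 hw1 (famEnum φ ad g) ε he2))
    rw [hcV]
    exact herr
  have hval : ∀ g j c, F g (extAssign φ (Sum.elim (ad j) c)) = true ↔ g j = c := by
    rintro g ⟨p, i⟩ c
    simp only [F, decide_eq_true_eq]
    constructor
    · rintro ⟨p', hp', i', h⟩
      rw [famEnum, dif_pos hp'] at h
      have h2 := extAssign_inj φ h
      have hA : ad (⟨p', hp'⟩, i') = ad (p, i) := funext fun u => congrFun h2 (Sum.inl u)
      have hB : g (⟨p', hp'⟩, i') = c := funext fun u => congrFun h2 (Sum.inr u)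
      rw [← ad.injective hA]
      exact hB
    · intro h
      refine ⟨p, p.2, i, ?_⟩
      rw [famEnum, dif_pos p.2, ← h]
  have hinj : Function.Injective
      (fun g => (fun y => F g (extAssign φ y) : (Fin l ⊕ Fin l → Bool) → Bool)) := by
    intro g g' h
    funext j
    have h1 := congrFun h (Sum.elim (ad j) (g j))
    simp only at h1
    rw [(hval g j (g j)).2 rfl] at h1
    exact ((hval g' j (g j)).1 h1.symm).symm
  have hle := Finset.card_le_card_of_injOn (s := Finset.univ) _ (fun g _ => hmem g)
    hinj.injOn
  have hb := boolNet_card (Fin l ⊕ Fin l) d (2 ^ q) (2 * k * Fintype.card (Fin l ⊕ Fin l))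
  rw [hcV] at hb hle
  have hlt := (hle.trans hb).trans_lt (count_lt hk hd1 hl hcount)
  rw [Finset.card_univ] at hlt
  simp only [Fintype.card_fun, Fintype.card_prod, Fintype.card_fin, Fintype.card_bool] at hlt
  rw [← pow_mul] at hlt
  exact lt_irrefl _ hlt
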